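/- Let a > 0 be a real number and define F : (0, ∞) → ℝ by F(k) = (1 - e^{-ak})^k. Then for every k > 0, F(k) ≥ (1/2)^{(ln 2)/a}, with equality exactly at k = (ln 2)/a. In Bloom filter terms: for fixed m and n with a = n/m, the approximate false positive rate (1 - e^{-kn/m})^k attains its global minimum over k ∈ (0, ∞) at k = (m ln 2)/n, and the minimum value is (1/2)^{(m ln 2)/n}. -/

import Mathlib

open Set in
/-- The product `log p * log (1 - p)` is strictly increasing on `(0, 1/2]`. -/
lemma strictMonoOn_log_mul_log_one_sub :
    StrictMonoOn (fun p : ℝ ↦ Real.log p * Real.log (1 - p)) (Ioc 0 (1 / 2)) := by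
  have hderiv : ∀ p : ℝ, 0 < p → p < 1 →
      HasDerivAt (fun p : ℝ ↦ Real.log p * Real.log (1 - p))
        (p⁻¹ * Real.log (1 - p) + Real.log p * (-1 / (1 - p))) p := fun p hp₀ hp₁ ↦
    (Real.hasDerivAt_log hp₀.ne').mul
      (((hasDerivAt_id p).const_sub 1).log (sub_ne_zero.2 hp₁.ne'))
  refine strictMonoOn_of_deriv_pos (convex_Ioc _ _) (fun p hp ↦ ?_) fun p hp ↦ ?_
  · exact (hderiv p hp.1 (by linarith [hp.2])).continuousAt.continuousWithinAt
  · rw [interior_Ioc] at hp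
    obtain ⟨hp₀, hp₁⟩ := hp
    rw [(hderiv p hp₀ (by linarith)).deriv]
    have h := strictConcaveOn_log_Ioi.secant_strict_mono (a := 1) (x := p) (y := 1 - p)
      (mem_Ioi.2 one_pos) (mem_Ioi.2 hp₀) (mem_Ioi.2 (by linarith)) (by linarith)
      (by linarith) (by linarith)
    have e₁ : (Real.log (1 - p) - Real.log 1) / (1 - p - 1) = -(p⁻¹ * Real.log (1 - p)) := by
      rw [Real.log_one, sub_zero, show 1 - p - 1 = -p by ring, div_neg, div_eq_inv_mul]
    have e₂ : (Real.log p - Real.log 1) / (p - 1) = Real.log p * (-1 / (1 - p)) := by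
      rw [Real.log_one, sub_zero, ← neg_sub 1 p, div_neg, neg_div, mul_neg, mul_one_div]
    rw [e₁, e₂] at h
    linarith

lemma log_mul_log_one_sub_lt {p : ℝ} (hp₀ : 0 < p) (hp₁ : p < 1) (hp : p ≠ 1 / 2) :
    Real.log p * Real.log (1 - p) < Real.log 2 ^ 2 := by
  have hmax : Real.log (1 / 2) * Real.log (1 - 1 / 2) = Real.log 2 ^ 2 := by
    rw [sub_half, one_div, Real.log_inv]
    ring
  rw [← hmax]
  have hhalf : (1 / 2 : ℝ) ∈ Set.Ioc (0 : ℝ) (1 / 2) := by norm_num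
  rcases lt_or_gt_of_ne hp with h | h
  · exact strictMonoOn_log_mul_log_one_sub ⟨hp₀, h.le⟩ hhalf h
  · have := strictMonoOn_log_mul_log_one_sub (a := 1 - p) ⟨by linarith, by linarith⟩ hhalf
      (by linarith)
    simpa only [sub_sub_cancel, mul_comm (Real.log (1 - p))] using this

lemma half_rpow_lt_one_sub_exp_rpow {a k : ℝ} (ha : 0 < a) (hk : 0 < k)
    (hne : k ≠ Real.log 2 / a) :
    (1 / 2 : ℝ) ^ (Real.log 2 / a) < (1 - Real.exp (-a * k)) ^ k := by
  have hexp : Real.exp (-a * k) < 1 := Real.exp_lt_one_iff.2 (by linarith [mul_pos ha hk])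
  have hhalf : Real.exp (-a * k) ≠ 1 / 2 := fun h ↦ hne <| by
    have h' := congrArg Real.log h
    rw [Real.log_exp, one_div, Real.log_inv] at h'
    rw [eq_div_iff ha.ne']
    linarith
  have h := log_mul_log_one_sub_lt (Real.exp_pos _) hexp hhalf
  rw [Real.log_exp] at h
  rw [Real.rpow_def_of_pos one_half_pos, Real.rpow_def_of_pos (sub_pos.2 hexp),
    Real.exp_lt_exp, one_div, Real.log_inv, ← mul_div_assoc, div_lt_iff₀ ha]
  linarith

lemma one_sub_exp_rpow_log_two_div {a : ℝ} (ha : a ≠ 0) :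
    (1 - Real.exp (-a * (Real.log 2 / a))) ^ (Real.log 2 / a) =
      (1 / 2 : ℝ) ^ (Real.log 2 / a) := by
  rw [neg_mul, mul_div_cancel₀ _ ha, Real.exp_neg, Real.exp_log two_pos]
  norm_num

/-- Let `a > 0` and `F k = (1 - e^(-a k))^k` (real exponent).  For every `k > 0`,
`F k ≥ (1/2)^((ln 2)/a)`, with equality exactly at `k = (ln 2)/a`.  In Bloom filter
terms (`a = n/m`): the approximate false positive rate attains its global minimum over
`k ∈ (0, ∞)` at `k = (m ln 2)/n`, with minimum value `(1/2)^((m ln 2)/n)`. -/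
theorem approx_fpr_global_min (a : ℝ) (ha : 0 < a) :
    (∀ k : ℝ, 0 < k →
      ((1 / 2 : ℝ) ^ (Real.log 2 / a)) ≤ (1 - Real.exp (-a * k)) ^ k) ∧
    (∀ k : ℝ, 0 < k →
      ((1 - Real.exp (-a * k)) ^ k = (1 / 2 : ℝ) ^ (Real.log 2 / a) ↔
        k = Real.log 2 / a)) := by
  refine ⟨fun k hk ↦ ?_, fun k hk ↦ ⟨fun h ↦ ?_, ?_⟩⟩
  · rcases eq_or_ne k (Real.log 2 / a) with rfl | hne
    · exact (one_sub_exp_rpow_log_two_div ha.ne').ge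
    · exact (half_rpow_lt_one_sub_exp_rpow ha hk hne).le
  · by_contra hne
    exact (half_rpow_lt_one_sub_exp_rpow ha hk hne).ne' h
  · rintro rfl
    exact one_sub_exp_rpow_log_two_div ha.ne'
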